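/- arXiv:2204.12925 — 2 statements merged into one kernel-verified Lean document; each statement's English description precedes it below -/
import Mathlib

section
/- Let b be a complex number with exp(b) ≠ 1. Then the series ∑_{n∈ℤ} 1/(b + 2πin)² converges absolutely and ∑_{n∈ℤ} 1/(b + 2πin)² = e^b/(1 − e^b)². -/
open Complex Real

lemma aux_upper (z : ℂ) (hz : 0 < z.im) :
    ∑' n : ℤ, 1 / (z + n) ^ 2 = (2 * (Real.pi : ℂ) * Complex.I) ^ 2 *
      (Complex.exp (2 * (Real.pi : ℂ) * Complex.I * z) /
        (1 - Complex.exp (2 * (Real.pi : ℂ) * Complex.I * z)) ^ 2) := by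
  have h := EisensteinSeries.qExpansion_identity (k := 1) le_rfl ⟨z, hz⟩
  have hn : ‖Complex.exp (2 * (Real.pi : ℂ) * Complex.I * z)‖ < 1 := by
    simpa using UpperHalfPlane.norm_exp_two_pi_I_lt_one ⟨z, hz⟩
  have h2 := tsum_coe_mul_geometric_of_norm_lt_one hn
  simp only [pow_one, Nat.factorial_one, Nat.cast_one, div_one] at h
  rw [← h2]
  simpa using h

lemma aux_summable (z : ℂ) : Summable (fun n : ℤ => 1 / (z + n) ^ 2) := by
  have h := EisensteinSeries.linear_right_summable z 1 (k := 2) le_rfl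
  refine h.congr fun n => ?_
  simp [zpow_ofNat]

lemma aux_lower (z : ℂ) (hz : z.im < 0) :
    ∑' n : ℤ, 1 / (z + n) ^ 2 = (2 * (Real.pi : ℂ) * Complex.I) ^ 2 *
      (Complex.exp (2 * (Real.pi : ℂ) * Complex.I * z) /
        (1 - Complex.exp (2 * (Real.pi : ℂ) * Complex.I * z)) ^ 2) := by
  have h := aux_upper (-z) (by simpa using hz)
  have h1 : ∑' n : ℤ, 1 / (z + n) ^ 2 = ∑' n : ℤ, 1 / (-z + n) ^ 2 := by
    rw [← (Equiv.neg ℤ).tsum_eq]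
    refine tsum_congr fun n => ?_
    simp only [Equiv.neg_apply, Int.cast_neg]
    congr 1
    ring
  rw [h1, h, mul_neg, Complex.exp_neg]
  congr 1
  have h0 := Complex.exp_ne_zero (2 * (Real.pi : ℂ) * Complex.I * z)
  generalize Complex.exp (2 * (Real.pi : ℂ) * Complex.I * z) = q at *
  have : (1 - q⁻¹) ^ 2 = (1 - q) ^ 2 / q ^ 2 := by
    field_simp
    ring
  rw [this]
  by_cases hq : 1 - q = 0
  · simp [hq]
  · field_simp

open Filter Topology in
lemma aux_real (z : ℂ) (hz : z.im = 0)
    (hq : Complex.exp (2 * (Real.pi : ℂ) * Complex.I * z) ≠ 1) :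
    ∑' n : ℤ, 1 / (z + n) ^ 2 = (2 * (Real.pi : ℂ) * Complex.I) ^ 2 *
      (Complex.exp (2 * (Real.pi : ℂ) * Complex.I * z) /
        (1 - Complex.exp (2 * (Real.pi : ℂ) * Complex.I * z)) ^ 2) := by
  have hne : ∀ n : ℤ, z + n ≠ 0 := by
    intro n hn
    apply hq
    rw [eq_neg_of_add_eq_zero_left hn, Complex.exp_eq_one_iff]
    exact ⟨-n, by push_cast; ring⟩
  have hw : Tendsto (fun t : ℝ => z + t * Complex.I) (𝓝[>] 0) (𝓝 z) := by
    have : Continuous (fun t : ℝ => z + t * Complex.I) := by fun_prop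
    have h := this.tendsto 0
    simp only [Complex.ofReal_zero, zero_mul, add_zero] at h
    exact h.mono_left nhdsWithin_le_nhds
  have h1 : Tendsto (fun t : ℝ => ∑' n : ℤ, 1 / (z + t * Complex.I + n) ^ 2) (𝓝[>] 0)
      (𝓝 (∑' n : ℤ, 1 / (z + n) ^ 2)) := by
    refine tendsto_tsum_of_dominated_convergence (bound := fun n : ℤ => ‖1 / (z + n) ^ 2‖)
      (aux_summable z).norm ?_ ?_
    · intro n
      exact tendsto_const_nhds.div ((hw.add_const _).pow 2) (pow_ne_zero 2 (hne n))
    · refine Eventually.of_forall fun t n => ?_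
      rw [norm_div, norm_div, norm_pow, norm_pow]
      have hp : 0 < ‖z + n‖ := norm_pos_iff.2 (hne n)
      have : ‖z + n‖ ≤ ‖z + t * Complex.I + n‖ := by
        have e : ‖z + n‖ = |(z + t * Complex.I + n).re| := by
          have : z + n = (((z + t * Complex.I + n).re : ℝ) : ℂ) := by
            apply Complex.ext <;> simp [hz]
          rw [this, Complex.norm_real, Real.norm_eq_abs]
        rw [e]
        exact Complex.abs_re_le_norm _
      gcongr
  have h2 : Tendsto (fun t : ℝ => ∑' n : ℤ, 1 / (z + t * Complex.I + n) ^ 2) (𝓝[>] 0)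
      (𝓝 ((2 * (Real.pi : ℂ) * Complex.I) ^ 2 *
      (Complex.exp (2 * (Real.pi : ℂ) * Complex.I * z) /
        (1 - Complex.exp (2 * (Real.pi : ℂ) * Complex.I * z)) ^ 2))) := by
    have he : Tendsto (fun t : ℝ => Complex.exp (2 * (Real.pi : ℂ) * Complex.I *
        (z + t * Complex.I))) (𝓝[>] 0)
        (𝓝 (Complex.exp (2 * (Real.pi : ℂ) * Complex.I * z))) :=
      (Complex.continuous_exp.tendsto _).comp (hw.const_mul _)
    have h3 := (he.div ((tendsto_const_nhds (x := (1 : ℂ))).sub he |>.pow 2)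
      (pow_ne_zero 2 (sub_ne_zero.2 hq.symm))).const_mul
        ((2 * (Real.pi : ℂ) * Complex.I) ^ 2)
    refine h3.congr' ?_
    filter_upwards [self_mem_nhdsWithin] with t ht
    exact (aux_upper _ (by simpa [hz] using ht)).symm
  exact tendsto_nhds_unique h1 h2



/-- Equation (2.9): for complex `b` with `e^b ≠ 1`,
`∑_{n∈ℤ} 1/(b + 2πin)² = e^b/(1 - e^b)²`, with absolute convergence. -/
theorem sum_inv_sq_b_add_two_pi_int_mul_I (b : ℂ) (hb : Complex.exp b ≠ 1) :
    Summable (fun n : ℤ => 1 / (b + 2 * (Real.pi : ℂ) * Complex.I * n) ^ 2) ∧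
    ∑' n : ℤ, 1 / (b + 2 * (Real.pi : ℂ) * Complex.I * n) ^ 2
      = Complex.exp b / (1 - Complex.exp b) ^ 2 := by
  have hc : (2 * (Real.pi : ℂ) * Complex.I) ≠ 0 := Complex.two_pi_I_ne_zero
  obtain ⟨z, rfl⟩ : ∃ z, b = 2 * (Real.pi : ℂ) * Complex.I * z :=
    ⟨b / (2 * (Real.pi : ℂ) * Complex.I), by field_simp⟩
  have e : (fun n : ℤ => 1 / (2 * (Real.pi : ℂ) * Complex.I * z +
      2 * (Real.pi : ℂ) * Complex.I * n) ^ 2) =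
      fun n : ℤ => ((2 * (Real.pi : ℂ) * Complex.I) ^ 2)⁻¹ * (1 / (z + n) ^ 2) := by
    funext n
    rw [← mul_add, mul_pow, one_div, mul_inv, one_div]
  rw [e]
  refine ⟨(aux_summable z).mul_left _, ?_⟩
  rw [tsum_mul_left, inv_mul_eq_iff_eq_mul₀ (pow_ne_zero 2 hc)]
  rcases lt_trichotomy z.im 0 with h | h | h
  · exact aux_lower z h
  · exact aux_real z h hb
  · exact aux_upper z h
end

section
/- Let ψ = Γ'/Γ be the digamma function, and let (ρ_n)_{n≥0} be real numbers with ψ(ρ_n) = 0 for all n, ρ₀ > 0, and ρ_n ∈ (−n, −n+1) for every n ≥ 1. Then the series ∑_{n=1}^∞ (1/ρ_n + 1/n) converges and 1/ρ₀ + ∑_{n=1}^∞ (1/ρ_n + 1/n) = −γ, where γ is the Euler–Mascheroni constant. -/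
open Real

/-- The digamma function `ψ = Γ'/Γ` on the reals. -/
noncomputable def digamma (x : ℝ) : ℝ := deriv Real.Gamma x / Real.Gamma x

open Filter Topology

lemma dg_add_one (x : ℝ) (hx : ∀ m : ℕ, x ≠ -m) : digamma (x + 1) = digamma x + 1 / x := by
  have h0 : x ≠ 0 := by simpa using hx 0
  have hG := Real.Gamma_ne_zero hx
  have hd := (Real.differentiableAt_Gamma hx).hasDerivAt
  have h1 : HasDerivAt (fun y : ℝ => y * Real.Gamma y) (1 * Real.Gamma x + x * deriv Real.Gamma x) x :=
    (hasDerivAt_id x).mul hd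
  have h2 : deriv (fun y => Real.Gamma (y + 1)) x = 1 * Real.Gamma x + x * deriv Real.Gamma x := by
    rw [← h1.deriv]
    apply Filter.EventuallyEq.deriv_eq
    filter_upwards [isOpen_ne.mem_nhds h0] with y hy
    exact Real.Gamma_add_one hy
  rw [deriv_comp_add_const] at h2
  unfold digamma
  rw [h2, Real.Gamma_add_one h0]
  field_simp
  ring

lemma dg_bounds (y : ℝ) (hy : 1 < y) : log (y - 1) ≤ digamma y ∧ digamma y ≤ log y := by
  have hne : ∀ m : ℕ, y ≠ -m := fun m h => by
    have : (0 : ℝ) ≤ m := m.cast_nonneg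
    linarith
  have hd : HasDerivAt (Real.log ∘ Real.Gamma) (digamma y) y :=
    (Real.differentiableAt_Gamma hne).hasDerivAt.log (Real.Gamma_ne_zero hne)
  have key : ∀ z : ℝ, 0 < z → log (Real.Gamma (z + 1)) = log z + log (Real.Gamma z) := fun z hz => by
    rw [Real.Gamma_add_one hz.ne', Real.log_mul hz.ne' (Real.Gamma_pos_of_pos hz).ne']
  have k1 := key y (by linarith)
  have k2 := key (y - 1) (by linarith)
  rw [sub_add_cancel] at k2
  constructor
  · have := Real.convexOn_log_Gamma.slope_le_of_hasDerivAt (x := y - 1) (y := y)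
      (by simp; linarith) (by simp; linarith) (by linarith) hd
    simp only [slope_def_field, Function.comp] at this
    rw [k2] at this
    simpa using this
  · have := Real.convexOn_log_Gamma.le_slope_of_hasDerivAt (x := y) (y := y + 1)
      (by simp; linarith) (by simp; linarith) (by linarith) hd
    simp only [slope_def_field, Function.comp] at this
    rw [k1] at this
    simpa using this

noncomputable def FF (N : ℕ) (x : ℝ) : ℝ := log N - ∑ k ∈ Finset.range (N + 1), 1 / (x + k)

lemma dg_add_nat (x : ℝ) (hx : ∀ m : ℕ, x ≠ -m) (N : ℕ) :
    digamma (x + N) = digamma x + ∑ k ∈ Finset.range N, 1 / (x + k) := by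
  induction N with
  | zero => simp
  | succ n ih =>
    rw [Finset.sum_range_succ, ← add_assoc, ← ih, ← dg_add_one]
    · push_cast; ring_nf
    · intro m h
      apply hx (m + n)
      push_cast; linarith

lemma log_lim (c : ℝ) : Tendsto (fun N : ℕ => log (c + N) - log N) atTop (𝓝 0) := by
  have h1 : Tendsto (fun N : ℕ => c / (N : ℝ) + 1) atTop (𝓝 (0 + 1)) :=
    (tendsto_const_div_atTop_nhds_zero_nat c).add_const 1
  have h2 := (Real.continuousAt_log (by norm_num : (0 + 1 : ℝ) ≠ 0)).tendsto.comp h1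
  simp only [zero_add, Real.log_one] at h2
  refine h2.congr' ?_
  have h3 : ∀ᶠ N : ℕ in atTop, 0 < c + N :=
    (tendsto_atTop_add_const_left _ c tendsto_natCast_atTop_atTop).eventually_gt_atTop 0
  filter_upwards [eventually_gt_atTop 0, h3] with N hN h3
  have : (0 : ℝ) < N := by exact_mod_cast hN
  simp only [Function.comp]
  rw [← Real.log_div h3.ne' this.ne']
  congr 1
  field_simp

lemma FF_lim (x : ℝ) (hx : ∀ m : ℕ, x ≠ -m) :
    Tendsto (fun N => FF N x) atTop (𝓝 (digamma x)) := by
  have e : ∀ N, FF N x = digamma x - (digamma (x + (N + 1 : ℕ)) - log N) := fun N => by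
    rw [dg_add_nat x hx, FF]; ring
  have h : Tendsto (fun N : ℕ => digamma (x + (N + 1 : ℕ)) - log N) atTop (𝓝 0) := by
    have h3 : ∀ᶠ N : ℕ in atTop, 0 < x + N :=
      (tendsto_atTop_add_const_left _ x tendsto_natCast_atTop_atTop).eventually_gt_atTop 0
    refine tendsto_of_tendsto_of_tendsto_of_le_of_le' (log_lim x) (log_lim (x + 1)) ?_ ?_
    · filter_upwards [h3] with N hN
      have := (dg_bounds (x + (N + 1 : ℕ)) (by push_cast; linarith)).1
      rw [show x + ((N + 1 : ℕ) : ℝ) - 1 = x + N by push_cast; ring] at this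
      linarith
    · filter_upwards [h3] with N hN
      have := (dg_bounds (x + (N + 1 : ℕ)) (by push_cast; linarith)).2
      rw [show log (x + ((N + 1 : ℕ) : ℝ)) = log (x + 1 + N) by push_cast; ring_nf] at this
      linarith
  have := h.const_sub (digamma x)
  rw [sub_zero] at this
  exact this.congr fun N => (e N).symm

lemma FF_mono (N : ℕ) (x y : ℝ) (hxy : x < y) (h : ∀ k : ℕ, 0 < (x + k) * (y + k)) :
    (y - x) / (x * y) ≤ FF N y - FF N x := by
  have e : FF N y - FF N x = ∑ k ∈ Finset.range (N + 1), (y - x) / ((x + k) * (y + k)) := by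
    unfold FF
    rw [show ∀ a b c : ℝ, a - b - (a - c) = c - b by intros; ring, ← Finset.sum_sub_distrib]
    refine Finset.sum_congr rfl fun k _ => ?_
    have h1 := left_ne_zero_of_mul (h k).ne'
    have h2 := right_ne_zero_of_mul (h k).ne'
    field_simp
    ring
  rw [e]
  have := Finset.single_le_sum (s := Finset.range (N + 1))
    (f := fun k : ℕ => (y - x) / ((x + k) * (y + k)))
    (fun k _ => div_nonneg (by linarith) (h k).le) (Finset.mem_range.2 N.succ_pos)
  simpa using this

lemma root_lim (I : Set ℝ) (hI : IsOpen I) (hI2 : I.OrdConnected)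
    (h : ∀ x ∈ I, ∀ y ∈ I, ∀ k : ℕ, 0 < (x + k) * (y + k)) (r : ℝ) (hr : r ∈ I)
    (hr0 : digamma r = 0) (x : ℕ → ℝ) (hx : ∀ᶠ N in atTop, x N ∈ I ∧ FF N (x N) = 0) :
    Tendsto x atTop (𝓝 r) := by
  have hne : ∀ x ∈ I, ∀ m : ℕ, x ≠ -m := fun x hx m e => by
    have := h x hx x hx m
    rw [e] at this; simp at this
  have hm : ∀ x ∈ I, ∀ y ∈ I, x < y → 0 < (y - x) / (x * y) := fun x hx y hy hxy =>
    div_pos (by linarith) (by simpa using h x hx y hy 0)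
  have hmono : ∀ N, ∀ x ∈ I, ∀ y ∈ I, x < y → FF N x < FF N y := fun N x hx y hy hxy => by
    have := FF_mono N x y hxy (h x hx y hy)
    have := hm x hx y hy hxy
    linarith
  have hdm : ∀ x ∈ I, ∀ y ∈ I, x < y → digamma x < digamma y := fun x hx y hy hxy => by
    have h1 := ge_of_tendsto' ((FF_lim y (hne y hy)).sub (FF_lim x (hne x hx)))
      (fun N => FF_mono N x y hxy (h x hx y hy))
    have := hm x hx y hy hxy
    linarith
  rw [tendsto_order]
  constructor
  · intro a ha
    have : ∀ᶠ z in 𝓝[<] r, z ∈ I ∧ a < z ∧ z < r := by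
      filter_upwards [nhdsWithin_le_nhds (hI.mem_nhds hr), nhdsWithin_le_nhds (lt_mem_nhds ha),
        self_mem_nhdsWithin] with z h1 h2 h3 using ⟨h1, h2, h3⟩
    obtain ⟨z, zI, az, zr⟩ := this.exists
    have hz := hdm z zI r hr zr
    rw [hr0] at hz
    filter_upwards [hx, (FF_lim z (hne z zI)).eventually_lt_const hz] with N ⟨h1, h2⟩ h3
    by_contra! hc
    have := hmono N (x N) h1 z zI (by linarith)
    linarith
  · intro a ha
    have : ∀ᶠ z in 𝓝[>] r, z ∈ I ∧ z < a ∧ r < z := by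
      filter_upwards [nhdsWithin_le_nhds (hI.mem_nhds hr), nhdsWithin_le_nhds (gt_mem_nhds ha),
        self_mem_nhdsWithin] with z h1 h2 h3 using ⟨h1, h2, h3⟩
    obtain ⟨z, zI, az, zr⟩ := this.exists
    have hz := hdm r hr z zI zr
    rw [hr0] at hz
    filter_upwards [hx, (FF_lim z (hne z zI)).eventually_const_lt hz] with N ⟨h1, h2⟩ h3
    by_contra! hc
    have := hmono N z zI (x N) h1 (by linarith)
    linarith

lemma FF_split (N m : ℕ) (hm : m ≤ N) (x : ℝ) :
    FF N x = (log N - ∑ k ∈ (Finset.range (N + 1)).erase m, 1 / (x + k)) + -(x + m)⁻¹ := by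
  rw [FF, ← Finset.add_sum_erase _ _ (Finset.mem_range.2 (Nat.lt_succ_of_le hm))]
  rw [one_div]; ring

lemma rest_lim (N m : ℕ) : ContinuousAt
    (fun x : ℝ => log N - ∑ k ∈ (Finset.range (N + 1)).erase m, 1 / (x + k)) (-(m : ℝ)) := by
  refine continuousAt_const.sub (tendsto_finsetSum _ fun k hk => ?_)
  refine ContinuousAt.div (by fun_prop) (by fun_prop) ?_
  have := Finset.ne_of_mem_erase hk
  have h2 : (k : ℝ) ≠ m := by exact_mod_cast this
  intro h; apply h2; linarith

lemma FF_right (N m : ℕ) (hm : m ≤ N) : Tendsto (FF N) (𝓝[>] (-(m : ℝ))) atBot := by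
  refine Tendsto.congr (fun x => (FF_split N m hm x).symm) ?_
  refine ((rest_lim N m).tendsto.mono_left nhdsWithin_le_nhds).add_atBot ?_
  refine tendsto_neg_atTop_atBot.comp (tendsto_inv_nhdsGT_zero.comp ?_)
  refine tendsto_nhdsWithin_iff.2 ⟨?_, ?_⟩
  · have : ContinuousAt (fun x : ℝ => x + m) (-(m : ℝ)) := by fun_prop
    have := this.tendsto
    simp only [neg_add_cancel] at this
    exact this.mono_left nhdsWithin_le_nhds
  · filter_upwards [self_mem_nhdsWithin] with x hx
    simp only [Set.mem_Ioi] at *; linarith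

lemma FF_left (N m : ℕ) (hm : m ≤ N) : Tendsto (FF N) (𝓝[<] (-(m : ℝ))) atTop := by
  refine Tendsto.congr (fun x => (FF_split N m hm x).symm) ?_
  refine ((rest_lim N m).tendsto.mono_left nhdsWithin_le_nhds).add_atTop ?_
  refine tendsto_neg_atBot_atTop.comp (tendsto_inv_nhdsLT_zero.comp ?_)
  refine tendsto_nhdsWithin_iff.2 ⟨?_, ?_⟩
  · have : ContinuousAt (fun x : ℝ => x + m) (-(m : ℝ)) := by fun_prop
    have := this.tendsto
    simp only [neg_add_cancel] at this
    exact this.mono_left nhdsWithin_le_nhds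
  · filter_upwards [self_mem_nhdsWithin] with x hx
    simp only [Set.mem_Iio] at *; linarith

lemma FF_top (N : ℕ) : Tendsto (FF N) atTop (𝓝 (log N)) := by
  have : Tendsto (fun x : ℝ => log N - ∑ k ∈ Finset.range (N + 1), 1 / (x + k)) atTop
      (𝓝 (log N - ∑ k ∈ Finset.range (N + 1), 0)) := by
    refine tendsto_const_nhds.sub (tendsto_finsetSum _ fun k hk => ?_)
    simp only [one_div]
    exact tendsto_inv_atTop_zero.comp (tendsto_atTop_add_const_right _ _ tendsto_id)
  rw [Finset.sum_const_zero, sub_zero] at this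
  exact this

/-- The intervals. -/
def II (n : ℕ) : Set ℝ := if n = 0 then Set.Ioi 0 else Set.Ioo (-(n : ℝ)) (-(n : ℝ) + 1)

lemma II_open (n : ℕ) : IsOpen (II n) := by
  unfold II; split_ifs
  exacts [isOpen_Ioi, isOpen_Ioo]

lemma II_conn (n : ℕ) : (II n).OrdConnected := by
  unfold II; split_ifs
  exacts [Set.ordConnected_Ioi, Set.ordConnected_Ioo]

lemma II_pos (n : ℕ) : ∀ x ∈ II n, ∀ y ∈ II n, ∀ k : ℕ, 0 < (x + k) * (y + k) := by
  intro x hx y hy k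
  have hk : (0 : ℝ) ≤ k := k.cast_nonneg
  unfold II at hx hy
  split_ifs at hx hy with h
  · simp only [Set.mem_Ioi] at hx hy
    positivity
  · obtain ⟨h1, h2⟩ := hx
    obtain ⟨h3, h4⟩ := hy
    rcases lt_or_ge k n with hkn | hkn
    · have : (k : ℝ) + 1 ≤ n := by exact_mod_cast hkn
      exact mul_pos_of_neg_of_neg (by linarith) (by linarith)
    · have : (n : ℝ) ≤ k := by exact_mod_cast hkn
      exact mul_pos (by linarith) (by linarith)

lemma II_ne (n : ℕ) (x : ℝ) (hx : x ∈ II n) (k : ℕ) : x + k ≠ 0 :=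
  left_ne_zero_of_mul (II_pos n x hx x hx k).ne'

lemma II_disj (n m : ℕ) (x : ℝ) (hx : x ∈ II n) (hy : x ∈ II m) : n = m := by
  unfold II at hx hy
  have hn0 : (0 : ℝ) ≤ n := n.cast_nonneg
  have hm0 : (0 : ℝ) ≤ m := m.cast_nonneg
  by_contra hne
  have : n + 1 ≤ m ∨ m + 1 ≤ n := by omega
  have : (n : ℝ) + 1 ≤ m ∨ (m : ℝ) + 1 ≤ n := by exact_mod_cast this
  have hn : n ≠ 0 → (1 : ℝ) ≤ n := fun h => by exact_mod_cast Nat.one_le_iff_ne_zero.2 h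
  have hm : m ≠ 0 → (1 : ℝ) ≤ m := fun h => by exact_mod_cast Nat.one_le_iff_ne_zero.2 h
  split_ifs at hx hy with h1 h2 h2 <;> simp only [Set.mem_Ioi, Set.mem_Ioo] at hx hy
  · omega
  · linarith [hm h2, hy.2]
  · linarith [hn h1, hx.2]
  · rcases this with h | h <;> linarith [hx.1, hx.2, hy.1, hy.2]

lemma root_exists (N : ℕ) (hN : 2 ≤ N) (n : ℕ) (hn : n ≤ N) : ∃ x ∈ II n, FF N x = 0 := by
  have hc : ContinuousOn (FF N) (II n) := by
    unfold FF
    refine continuousOn_const.sub (continuousOn_finsetSum _ fun k hk => ?_)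
    exact ContinuousOn.div (by fun_prop) (by fun_prop) (fun x hx => II_ne n x hx k)
  have ha : ∃ a ∈ II n, FF N a ≤ 0 := by
    have h1 : ∀ᶠ a in 𝓝[>] (-(n : ℝ)), a ∈ II n := by
      by_cases h : n = 0
      · simp only [II, h, if_true]
        rw [Nat.cast_zero, neg_zero]
        exact self_mem_nhdsWithin
      · simp only [II, h, if_false]
        exact Ioo_mem_nhdsGT (by linarith)
    obtain ⟨a, h2, h3⟩ := (h1.and ((FF_right N n hn).eventually_le_atBot 0)).exists
    exact ⟨a, h2, h3⟩
  have hb : ∃ b ∈ II n, 0 ≤ FF N b := by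
    by_cases h : n = 0
    · have hl : 0 < log N := Real.log_pos (by exact_mod_cast hN)
      obtain ⟨b, h2, h3⟩ := ((eventually_gt_atTop 0).and
        ((FF_top N).eventually_const_lt hl)).exists
      exact ⟨b, by simpa [II, h] using h2, h3.le⟩
    · have h1 : ∀ᶠ a in 𝓝[<] (-((n - 1 : ℕ) : ℝ)), a ∈ II n := by
        rw [Nat.cast_sub (Nat.one_le_iff_ne_zero.2 h)]
        simp only [II, h, if_false]
        rw [show -((n : ℝ) - (1 : ℕ)) = -(n : ℝ) + 1 by push_cast; ring]
        exact Ioo_mem_nhdsLT (by linarith)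
      obtain ⟨a, h2, h3⟩ := (h1.and ((FF_left N (n - 1) (by omega)).eventually_ge_atTop 0)).exists
      exact ⟨a, h2, h3⟩
  obtain ⟨a, ha, ha'⟩ := ha
  obtain ⟨b, hb, hb'⟩ := hb
  obtain ⟨x, hx, hx'⟩ := (II_conn n).isPreconnected.intermediate_value ha hb hc ⟨ha', hb'⟩
  exact ⟨x, hx, hx'⟩

open Polynomial in
lemma prod_deriv {ι : Type} (s : Finset ι) (a : ι → ℝ) (t : ℝ) (h : ∀ i ∈ s, t - a i ≠ 0) :
    (derivative (∏ i ∈ s, (X - C (a i)))).eval t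
      = (∏ i ∈ s, (X - C (a i))).eval t * ∑ i ∈ s, 1 / (t - a i) := by
  classical
  induction s using Finset.induction_on with
  | empty => simp
  | insert i s hi ih =>
    rw [Finset.prod_insert hi, Finset.sum_insert hi, derivative_mul]
    have := ih fun j hj => h j (Finset.mem_insert_of_mem hj)
    have h0 := h i (Finset.mem_insert_self _ _)
    simp only [eval_add, eval_mul, this, derivative_sub, derivative_X, derivative_C, eval_sub,
      eval_X, eval_C, sub_zero, eval_one]
    field_simp

open Polynomial in
lemma sum_roots (N : ℕ) (x : ℕ → ℝ) (hx : ∀ n ≤ N, x n ∈ II n ∧ FF N (x n) = 0) :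
    ∑ n ∈ Finset.range (N + 1), 1 / x n
      = log N - 2 * ∑ k ∈ Finset.range N, 1 / ((k : ℝ) + 1) := by
  obtain ⟨R, hR⟩ : ∃ R : ℝ[X], R = ∏ k ∈ Finset.range N, (X - C (-((k : ℝ) + 1))) := ⟨_, rfl⟩
  have hRd : R.natDegree = N := by rw [hR, natDegree_finsetProd_X_sub_C_eq_card]; simp
  have hRe : ∀ t : ℝ, (∀ k : ℕ, t + (k + 1) ≠ 0) → R.eval t ≠ 0 ∧
      (derivative R).eval t = R.eval t * ∑ k ∈ Finset.range N, 1 / (t + (k + 1)) := by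
    intro t ht
    constructor
    · rw [hR, eval_prod, Finset.prod_ne_zero_iff]
      intro k _
      simpa only [eval_sub, eval_X, eval_C, sub_neg_eq_add] using ht k
    · have := prod_deriv (Finset.range N) (fun k => -((k : ℝ) + 1)) t
        (fun k _ => by simpa only [sub_neg_eq_add] using ht k)
      rw [← hR] at this
      simpa only [sub_neg_eq_add] using this
  obtain ⟨P, hP⟩ : ∃ P : ℝ[X], P = C (log N) * X * R - R - X * derivative R := ⟨_, rfl⟩
  have hPd : P.natDegree ≤ N + 1 := by
    have h1 : (derivative R).natDegree ≤ N := (natDegree_derivative_le R).trans (by omega)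
    have h2 : (C (log N) * X * R : ℝ[X]).natDegree ≤ N + 1 := by
      refine natDegree_mul_le.trans ?_
      have : (C (log N) * X : ℝ[X]).natDegree ≤ 1 := (natDegree_C_mul_le _ _).trans natDegree_X_le
      omega
    have h3 : (X * derivative R : ℝ[X]).natDegree ≤ N + 1 := by
      refine natDegree_mul_le.trans ?_
      rw [natDegree_X]; omega
    rw [hP]
    refine (natDegree_sub_le_of_le (natDegree_sub_le_of_le h2 (hRd.le.trans (Nat.le_succ N))) h3).trans ?_
    simp
  have hroot : ∀ n ≤ N, P.IsRoot (x n) := by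
    intro n hn
    obtain ⟨h1, h2⟩ := hx n hn
    have hne := II_ne n _ h1
    obtain ⟨-, h4⟩ := hRe (x n) (fun k => by simpa using hne (k + 1))
    have h0 : x n ≠ 0 := by simpa using hne 0
    rw [FF, Finset.sum_range_succ'] at h2
    simp only [Nat.cast_add, Nat.cast_one, Nat.cast_zero, add_zero] at h2
    rw [IsRoot, hP]
    simp only [eval_sub, eval_mul, eval_C, eval_X, h4]
    have h5 : log N = ∑ k ∈ Finset.range N, 1 / (x n + (k + 1)) + 1 / x n := by linarith
    rw [h5]
    field_simp
    ring
  have hdvd : (∏ n ∈ Finset.range (N + 1), (X - C (x n))) ∣ P := by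
    refine Finset.prod_dvd_of_coprime ?_ ?_
    · intro i hi j hj hij
      refine isCoprime_X_sub_C_of_isUnit_sub ?_
      refine (sub_ne_zero.2 fun e => hij ?_).isUnit
      have hi' := (hx i (by simpa using hi)).1
      have hj' := (hx j (by simpa using hj)).1
      rw [e] at hi'
      exact II_disj i j _ hi' hj'
    · intro i hi
      exact dvd_iff_isRoot.2 (hroot i (by simpa using hi))
  obtain ⟨S, hS⟩ := hdvd
  obtain ⟨D, hD⟩ : ∃ D : ℝ[X], D = ∏ n ∈ Finset.range (N + 1), (X - C (x n)) := ⟨_, rfl⟩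
  have hDm : D.natDegree = N + 1 := by rw [hD, natDegree_finsetProd_X_sub_C_eq_card]; simp
  have hx0 : ∀ n ∈ Finset.range (N + 1), (0 : ℝ) - x n ≠ 0 := by
    intro n hn
    have := II_ne n _ (hx n (by simpa using hn)).1 0
    simpa using this
  have hD' := prod_deriv (Finset.range (N + 1)) x 0 hx0
  rw [← hD] at hD' hS
  obtain ⟨hR0, hR1⟩ := hRe 0 (fun k => by positivity)
  have hP0 : P.eval 0 = - R.eval 0 := by rw [hP]; simp
  have hP1 : (derivative P).eval 0 = log N * R.eval 0 - 2 * (derivative R).eval 0 := by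
    rw [hP]; simp [derivative_mul]; ring
  have hPne : P ≠ 0 := by rintro rfl; simp at hP0; exact hR0 hP0
  have hSd : S.natDegree = 0 := by
    have hD0 : D ≠ 0 := by rintro rfl; simp at hS; exact hPne hS
    have hS0 : S ≠ 0 := by rintro rfl; simp at hS; exact hPne hS
    rw [hS, natDegree_mul hD0 hS0] at hPd
    omega
  obtain ⟨c, rfl⟩ := natDegree_eq_zero.1 hSd
  have e0 : D.eval 0 * c = - R.eval 0 := by rw [← hP0, hS]; simp
  have e1 : (derivative D).eval 0 * c = log N * R.eval 0 - 2 * (derivative R).eval 0 := by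
    rw [← hP1, hS]; simp [derivative_mul]
  rw [hD', mul_right_comm, e0, hR1] at e1
  simp only [zero_sub, zero_add, one_div_neg_eq_neg_one_div, Finset.sum_neg_distrib] at e1
  apply mul_left_cancel₀ hR0
  linear_combination e1

theorem term_bound (n : ℕ) (hn : n ≠ 0) (x : ℝ) (hx : x ∈ II (n + 1)) :
    ‖1 / x + 1 / ((n : ℝ) + 1)‖ ≤ 1 / (n : ℝ) ^ 2 := by
  simp only [II, Nat.succ_ne_zero, if_false] at hx
  push_cast at hx
  obtain ⟨h1, h2⟩ := hx
  have hn1 : (1 : ℝ) ≤ n := by exact_mod_cast Nat.one_le_iff_ne_zero.2 hn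
  have hx : x < -n := by linarith
  have hx0 : x ≠ 0 := by linarith
  have hn0 : (n : ℝ) + 1 ≠ 0 := by linarith
  have e : 1 / x + 1 / ((n : ℝ) + 1) = -((n + 1 + x) / (-x * (n + 1))) := by
    field_simp
  rw [e, norm_neg, Real.norm_of_nonneg (div_nonneg (by linarith) (mul_nonneg (by linarith) (by linarith)))]
  apply div_le_div₀ zero_le_one (by linarith) (by positivity)
  nlinarith

/-- Equation (4.2): the zeros `ρ₀ > 0` and `ρ_n ∈ (-n, -n+1)` (`n ≥ 1`) of the digamma
function satisfy `1/ρ₀ + ∑_{n≥1} (1/ρ_n + 1/n) = -γ`. -/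
theorem sum_inv_digamma_zeros_paired (ρ : ℕ → ℝ)
    (hzero : ∀ n, digamma (ρ n) = 0) (hpos : 0 < ρ 0)
    (hloc : ∀ n : ℕ, 1 ≤ n → ρ n ∈ Set.Ioo (-(n : ℝ)) (-(n : ℝ) + 1)) :
    Summable (fun n : ℕ => 1 / ρ (n + 1) + 1 / ((n : ℝ) + 1)) ∧
    1 / ρ 0 + ∑' n : ℕ, (1 / ρ (n + 1) + 1 / ((n : ℝ) + 1))
      = -Real.eulerMascheroniConstant := by
  have hI : ∀ n, ρ n ∈ II n := by
    intro n
    by_cases h : n = 0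
    · subst h; simpa [II] using hpos
    · simpa only [II, h, if_false] using hloc n (Nat.one_le_iff_ne_zero.2 h)
  have hρ0 : ∀ n, ρ n ≠ 0 := fun n => by simpa using II_ne n _ (hI n) 0
  have hex : ∀ N n : ℕ, ∃ x : ℝ, 2 ≤ N → n ≤ N → x ∈ II n ∧ FF N x = 0 := by
    intro N n
    by_cases h : 2 ≤ N ∧ n ≤ N
    · obtain ⟨x, h1, h2⟩ := root_exists N h.1 n h.2
      exact ⟨x, fun _ _ => ⟨h1, h2⟩⟩
    · exact ⟨0, fun a b => absurd ⟨a, b⟩ h⟩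
  choose x hx using hex
  have hlim : ∀ n, Tendsto (fun N => x N n) atTop (𝓝 (ρ n)) := by
    intro n
    refine root_lim (II n) (II_open n) (II_conn n) (II_pos n) _ (hI n) (hzero n) _ ?_
    filter_upwards [eventually_ge_atTop 2, eventually_ge_atTop n] with N h1 h2 using hx N n h1 h2
  have hlim' : ∀ n, Tendsto (fun N => 1 / x N n) atTop (𝓝 (1 / ρ n)) := fun n =>
    tendsto_const_nhds.div (hlim n) (hρ0 n)
  let g : ℕ → ℝ := fun n => 1 / ρ (n + 1) + 1 / ((n : ℝ) + 1)
  let f : ℕ → ℕ → ℝ := fun N n => if n < N then 1 / x N (n + 1) + 1 / ((n : ℝ) + 1) else 0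
  let b : ℕ → ℝ := fun n => 1 / (n : ℝ) ^ 2 + if n = 0 then ‖g 0‖ + 1 else 0
  have hb : Summable b := by
    refine (Real.summable_one_div_nat_pow.2 one_lt_two).add ?_
    refine summable_of_ne_finset_zero (s := {0}) fun n hn => ?_
    rw [Finset.mem_singleton] at hn
    rw [if_neg hn]
  have hfg : ∀ n, Tendsto (fun N => f N n) atTop (𝓝 (g n)) := by
    intro n
    refine ((hlim' (n + 1)).add_const (1 / ((n : ℝ) + 1))).congr' ?_
    filter_upwards [eventually_gt_atTop n] with N hN
    simp only [f, if_pos hN]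
  have hgb : ∀ n, ‖g n‖ ≤ b n := by
    intro n
    by_cases h : n = 0
    · subst h; simp [b]
    · simpa [b, h, g] using term_bound n h _ (hI (n + 1))
  have hg : Summable g := Summable.of_norm_bounded hb hgb
  refine ⟨hg, ?_⟩
  have hT : Tendsto (fun N => ∑' n, f N n) atTop (𝓝 (∑' n, g n)) := by
    refine tendsto_tsum_of_dominated_convergence hb hfg ?_
    have h0 := (hfg 0).norm.eventually_lt_const (lt_add_one ‖g 0‖)
    filter_upwards [h0, eventually_ge_atTop 2] with N h0 hN n
    by_cases h : n = 0
    · subst h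
      simpa [b] using h0.le
    · by_cases hn : n < N
      · have := term_bound n h _ (hx N (n + 1) hN hn).1
        simpa [f, b, h, hn] using this
      · simp only [f, if_neg hn, norm_zero]
        exact (norm_nonneg _).trans (hgb n)
  have hsum := (hlim' 0).add hT
  refine tendsto_nhds_unique hsum ?_
  refine Real.tendsto_harmonic_sub_log.neg.congr' ?_
  filter_upwards [eventually_ge_atTop 2] with N hN
  have hs := sum_roots N (x N) (fun n hn => hx N n hN hn)
  have ht : ∑' n, f N n = ∑ n ∈ Finset.range N, (1 / x N (n + 1) + 1 / ((n : ℝ) + 1)) := by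
    rw [tsum_eq_sum (s := Finset.range N)]
    · refine Finset.sum_congr rfl fun n hn => ?_
      simp only [f, if_pos (Finset.mem_range.1 hn)]
    · intro n hn
      simp only [f, if_neg (fun h => hn (Finset.mem_range.2 h))]
  have hh : ((harmonic N : ℚ) : ℝ) = ∑ k ∈ Finset.range N, 1 / ((k : ℝ) + 1) := by
    simp [harmonic]
  rw [ht, hh, Finset.sum_add_distrib]
  rw [Finset.sum_range_succ'] at hs
  linarith
end
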